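/- arXiv:1102.5434 — 2 statements merged into one kernel-verified Lean document; each statement's English description precedes it below -/
import Mathlib

section
/- For every k ≥ 1 and every f ∈ M with D f = 0, one has Dᵏ( xᵏ ( Q_k f ) ) = f; that is, Q_k is a right inverse of the mapping Dᵏ∘xᵏ on ker D. -/
/-- The operator `U_s`: `U_{2k} = k·id` and `U_{2k+1} = E + (n/2 + k)·id`. -/
noncomputable def Uop {M : Type*} [AddCommGroup M] [Module ℝ M]
    (n : ℕ) (E : Module.End ℝ M) (s : ℕ) : Module.End ℝ M :=
  if s % 2 = 0 then ((s / 2 : ℕ) : ℝ) • (1 : Module.End ℝ M)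
  else E + (((n : ℝ) / 2) + ((s / 2 : ℕ) : ℝ)) • (1 : Module.End ℝ M)

/-- The inverse `(U_s)⁻¹`: `(U_{2j})⁻¹ = (1/j)·id` and `(U_{2j+1})⁻¹ = I_j`. -/
noncomputable def UopInv {M : Type*} [AddCommGroup M] [Module ℝ M]
    (I : ℕ → Module.End ℝ M) (s : ℕ) : Module.End ℝ M :=
  if s % 2 = 0 then ((1 : ℝ) / ((s / 2 : ℕ) : ℝ)) • (1 : Module.End ℝ M)
  else I (s / 2)

/-- The operator `Q_k = (−1/2)ᵏ (U_k)⁻¹∘(U_{k−1})⁻¹∘⋯∘(U_1)⁻¹`. -/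
noncomputable def Qop {M : Type*} [AddCommGroup M] [Module ℝ M]
    (I : ℕ → Module.End ℝ M) : ℕ → Module.End ℝ M
  | 0 => 1
  | k + 1 => ((-1 : ℝ) / 2) • (UopInv I (k + 1) * Qop I k)

section OspRelations

variable {M : Type*} [AddCommGroup M] [Module ℝ M] {n : ℕ} {x D E : Module.End ℝ M}
  {I : ℕ → Module.End ℝ M}

theorem euler_apply_pow (hEx : E * x - x * E = x) (m : ℕ) (g : M) :
    E ((x ^ m) g) = (x ^ m) (E g) + (m : ℝ) • (x ^ m) g := by
  have h (v : M) : E (x v) = x (E v) + x v := by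
    have := LinearMap.congr_fun hEx v
    simp only [LinearMap.sub_apply, Module.End.mul_apply] at this
    rw [sub_eq_iff_eq_add] at this
    rw [this, add_comm]
  induction m with
  | zero => simp
  | succ m ih =>
    simp only [pow_succ', Module.End.mul_apply, h, ih, map_add, map_smul]
    push_cast
    module

theorem dirac_apply_pow_succ
    (hxD : x * D + D * x = (-2 : ℝ) • E - (n : ℝ) • (1 : Module.End ℝ M))
    (hEx : E * x - x * E = x) (m : ℕ) (g : M) :
    D ((x ^ (m + 1)) g) =
      (-2 : ℝ) • (x ^ m) (E g) - (2 * m + n : ℝ) • (x ^ m) g - x (D ((x ^ m) g)) := by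
  have := LinearMap.congr_fun hxD ((x ^ m) g)
  simp only [LinearMap.add_apply, LinearMap.sub_apply, LinearMap.smul_apply,
    Module.End.mul_apply, Module.End.one_apply, euler_apply_pow hEx] at this
  rw [pow_succ', Module.End.mul_apply, eq_sub_iff_add_eq', this]
  module

theorem dirac_apply_pow_of_mem_ker
    (hxD : x * D + D * x = (-2 : ℝ) • E - (n : ℝ) • (1 : Module.End ℝ M))
    (hEx : E * x - x * E = x) {g : M} (hg : D g = 0) (s : ℕ) :
    D ((x ^ (s + 1)) g) = (-2 : ℝ) • (x ^ s) (Uop n E (s + 1) g) := by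
  induction s with
  | zero =>
    rw [dirac_apply_pow_succ hxD hEx]
    simp only [Uop, pow_zero, Module.End.one_apply, hg, map_zero]
    norm_num
    module
  | succ s ih =>
    rw [dirac_apply_pow_succ hxD hEx, ih, map_smul, ← Module.End.mul_apply x, ← pow_succ']
    obtain ⟨j, rfl | rfl⟩ := Nat.even_or_odd' s
    · have h1 : (2 * j + 1) % 2 = 1 := by lia
      have h2 : (2 * j + 1 + 1) % 2 = 0 := by lia
      have h3 : (2 * j + 1) / 2 = j := by lia
      have h4 : (2 * j + 1 + 1) / 2 = j + 1 := by lia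
      simp only [Uop, h1, h2, h3, h4, one_ne_zero, if_true, if_false, LinearMap.add_apply,
        LinearMap.smul_apply, Module.End.one_apply, map_add, map_smul]
      push_cast
      module
    · have h1 : (2 * j + 1 + 1) % 2 = 0 := by lia
      have h2 : (2 * j + 1 + 1 + 1) % 2 = 1 := by lia
      have h3 : (2 * j + 1 + 1) / 2 = j + 1 := by lia
      have h4 : (2 * j + 1 + 1 + 1) / 2 = j + 1 := by lia
      simp only [Uop, h1, h2, h3, h4, one_ne_zero, if_true, if_false, LinearMap.add_apply,
        LinearMap.smul_apply, Module.End.one_apply, map_add, map_smul]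
      push_cast
      module

theorem Uop_mul_UopInv
    (hI : ∀ j : ℕ, (E + (((n : ℝ) / 2) + (j : ℝ)) • (1 : Module.End ℝ M)) * I j = 1)
    (s : ℕ) : Uop n E (s + 1) * UopInv I (s + 1) = 1 := by
  unfold Uop UopInv
  split_ifs with h
  · have : (((s + 1) / 2 : ℕ) : ℝ) ≠ 0 := by
      rw [Nat.cast_ne_zero]
      lia
    rw [smul_mul_smul_comm, mul_one_div_cancel this, one_smul, one_mul]
  · exact hI _

theorem dirac_UopInv_apply_eq_zero (hED : E * D - D * E = -D)
    (hI : ∀ j : ℕ,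
      (E + (((n : ℝ) / 2) + (j : ℝ)) • (1 : Module.End ℝ M)) * I j = 1 ∧
      I j * (E + (((n : ℝ) / 2) + (j : ℝ)) • (1 : Module.End ℝ M)) = 1)
    (s : ℕ) {g : M} (hg : D g = 0) : D (UopInv I s g) = 0 := by
  unfold UopInv
  split_ifs with h
  · simp [hg]
  · generalize s / 2 = j
    have hcomm : (E + (((n : ℝ) / 2) + ((j + 1 : ℕ) : ℝ)) • (1 : Module.End ℝ M)) * D =
        D * (E + (((n : ℝ) / 2) + (j : ℝ)) • (1 : Module.End ℝ M)) := by
      have hED' : E * D = D * E - D := by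
        rw [sub_eq_iff_eq_add] at hED
        rw [hED]
        abel
      simp only [add_mul, mul_add, smul_mul_assoc, mul_smul_comm, one_mul, mul_one, hED']
      push_cast
      module
    have hD : D * I j = I (j + 1) * D := by
      calc D * I j = I (j + 1) *
            ((E + (((n : ℝ) / 2) + ((j + 1 : ℕ) : ℝ)) • (1 : Module.End ℝ M)) * D) * I j := by
            rw [← mul_assoc (I (j + 1)), (hI (j + 1)).2, one_mul]
        _ = I (j + 1) * D := by
            rw [hcomm, mul_assoc, mul_assoc, (hI j).1, mul_one]
    rw [← Module.End.mul_apply, hD, Module.End.mul_apply, hg, map_zero]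

theorem dirac_Qop_apply_eq_zero (hED : E * D - D * E = -D)
    (hI : ∀ j : ℕ,
      (E + (((n : ℝ) / 2) + (j : ℝ)) • (1 : Module.End ℝ M)) * I j = 1 ∧
      I j * (E + (((n : ℝ) / 2) + (j : ℝ)) • (1 : Module.End ℝ M)) = 1)
    (k : ℕ) {f : M} (hf : D f = 0) : D (Qop I k f) = 0 := by
  induction k with
  | zero => exact hf
  | succ k ih =>
    rw [Qop, LinearMap.smul_apply, map_smul, Module.End.mul_apply,
      dirac_UopInv_apply_eq_zero hED hI _ ih, smul_zero]

end OspRelations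

/-- for `k ≥ 1` and `f ∈ ker D`, `Dᵏ(xᵏ(Q_k f)) = f`; that is, `Q_k` is a
right inverse of `Dᵏ∘xᵏ` on `ker D`. -/
theorem Qop_right_inverse
    {M : Type*} [AddCommGroup M] [Module ℝ M] (n : ℕ) (hn : 0 < n)
    (x D E : Module.End ℝ M) (I : ℕ → Module.End ℝ M)
    (hxD : x * D + D * x = (-2 : ℝ) • E - (n : ℝ) • (1 : Module.End ℝ M))
    (hEx : E * x - x * E = x)
    (hED : E * D - D * E = -D)
    (hI : ∀ j : ℕ,
      (E + (((n : ℝ) / 2) + (j : ℝ)) • (1 : Module.End ℝ M)) * I j = 1 ∧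
      I j * (E + (((n : ℝ) / 2) + (j : ℝ)) • (1 : Module.End ℝ M)) = 1)
    (k : ℕ) (hk : 1 ≤ k) :
    ∀ f : M, D f = 0 → (D ^ k) ((x ^ k) ((Qop I k) f)) = f := by
  intro f hf
  clear hk
  induction k with
  | zero => rfl
  | succ k ih =>
    rw [pow_succ D, Module.End.mul_apply,
      dirac_apply_pow_of_mem_ker hxD hEx (dirac_Qop_apply_eq_zero hED hI (k + 1) hf),
      Qop, LinearMap.smul_apply, Module.End.mul_apply, map_smul (Uop _ _ _),
      ← Module.End.mul_apply (Uop _ _ _),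
      Uop_mul_UopInv fun j => (hI j).1, Module.End.one_apply, map_smul, map_smul, map_smul, ih,
      smul_smul]
    norm_num
end

section
/- For all natural numbers s ≥ k ≥ 1 and every f ∈ M with D f = 0, one has Dᵏ( xˢ f ) = (−2)ᵏ x^{s−k} ( U_{s−k+1}( U_{s−k+2}( ⋯ ( U_{s−1}( U_s f ) ) ) ) ). In particular Dᵏ maps the subspace xˢ(ker D) into the subspace x^{s−k}(ker D). -/
section UmbralDirac

variable {M : Type*} [AddCommGroup M] [Module ℝ M] {n : ℕ} {x D E : Module.End ℝ M}

theorem Uop_add_Uop_succ (n : ℕ) (E : Module.End ℝ M) (s : ℕ) :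
    Uop n E s + Uop n E (s + 1) = E + ((n : ℝ) / 2 + s) • (1 : Module.End ℝ M) := by
  obtain ⟨j, rfl | rfl⟩ := Nat.even_or_odd' s
  · have h1 : (2 * j) % 2 = 0 := by omega
    have h2 : ¬ (2 * j + 1) % 2 = 0 := by omega
    have h3 : 2 * j / 2 = j := by omega
    have h4 : (2 * j + 1) / 2 = j := by omega
    rw [Uop, Uop, if_pos h1, if_neg h2, h3, h4]
    push_cast
    module
  · have h1 : ¬ (2 * j + 1) % 2 = 0 := by omega
    have h2 : (2 * j + 1 + 1) % 2 = 0 := by omega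
    have h3 : (2 * j + 1) / 2 = j := by omega
    have h4 : (2 * j + 1 + 1) / 2 = j + 1 := by omega
    rw [Uop, Uop, if_neg h1, if_pos h2, h3, h4]
    push_cast
    module

theorem apply_Uop_eq_zero (hED : E * D - D * E = -D) (s : ℕ) {f : M} (hf : D f = 0) :
    D (Uop n E s f) = 0 := by
  have hDE : D (E f) = 0 := by
    simpa [hf] using LinearMap.congr_fun hED f
  unfold Uop
  split_ifs <;> simp [hf, hDE]

theorem apply_list_prod_Uop_eq_zero (hED : E * D - D * E = -D) (l : List ℕ) {f : M}
    (hf : D f = 0) : D ((l.map (Uop n E)).prod f) = 0 := by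
  induction l with
  | nil => simpa using hf
  | cons a l ih => simpa using apply_Uop_eq_zero hED a ih

theorem euler_mul_pow (hEx : E * x - x * E = x) (s : ℕ) :
    E * x ^ s = x ^ s * E + (s : ℝ) • x ^ s := by
  induction s with
  | zero => simp
  | succ s ih =>
    have hcomm : E * x = x * E + x := by rw [← sub_eq_iff_eq_add', hEx]
    rw [pow_succ, ← mul_assoc, ih, add_mul, mul_assoc, hcomm, mul_add, smul_mul_assoc,
      mul_assoc (x ^ s) x E]
    push_cast
    module

theorem dirac_pow_succ_apply
    (hxD : x * D + D * x = (-2 : ℝ) • E - (n : ℝ) • (1 : Module.End ℝ M))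
    (hEx : E * x - x * E = x) (s : ℕ) {f : M} (hf : D f = 0) :
    D ((x ^ (s + 1)) f) = (-2 : ℝ) • (x ^ s) (Uop n E (s + 1) f) := by
  have anticomm (v : M) : D (x v) = (-2 : ℝ) • E v - (n : ℝ) • v - x (D v) := by
    rw [eq_sub_iff_add_eq']
    simpa using LinearMap.congr_fun hxD v
  induction s with
  | zero =>
    simp only [zero_add, pow_one, pow_zero, anticomm, hf, Uop]
    norm_num
    module
  | succ s ih =>
    have hE : E ((x ^ (s + 1)) f) = (x ^ (s + 1)) (E f) + ((s + 1 : ℕ) : ℝ) • (x ^ (s + 1)) f := by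
      simpa using LinearMap.congr_fun (euler_mul_pow hEx (s + 1)) f
    have hU : Uop n E (s + 1 + 1) f
        = E f + ((n : ℝ) / 2 + (s + 1 : ℕ)) • f - Uop n E (s + 1) f := by
      rw [eq_sub_iff_add_eq']
      simpa using LinearMap.congr_fun (Uop_add_Uop_succ n E (s + 1)) f
    rw [pow_succ' x (s + 1), Module.End.mul_apply, anticomm, ih, hE, hU, map_smul,
      ← Module.End.mul_apply x, ← pow_succ', map_sub, map_add, map_smul]
    module

theorem dirac_pow_pow_apply
    (hxD : x * D + D * x = (-2 : ℝ) • E - (n : ℝ) • (1 : Module.End ℝ M))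
    (hEx : E * x - x * E = x) (hED : E * D - D * E = -D) (m k : ℕ) {f : M} (hf : D f = 0) :
    (D ^ k) ((x ^ (m + k)) f) = ((-2 : ℝ)) ^ k •
      (x ^ m) (((List.range k).map (fun i => Uop n E (m + 1 + i))).prod f) := by
  induction k generalizing f with
  | zero => simp
  | succ k ih =>
    rw [pow_succ D, Module.End.mul_apply, ← add_assoc, dirac_pow_succ_apply hxD hEx _ hf,
      map_smul, ih (apply_Uop_eq_zero hED _ hf), smul_smul, ← pow_succ', List.range_succ,
      List.map_append, List.prod_append, Module.End.mul_apply, List.map_singleton,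
      List.prod_singleton, Nat.add_right_comm m 1 k]

end UmbralDirac

/-- for `s ≥ k ≥ 1` and `f ∈ ker D`,
`Dᵏ(xˢ f) = (−2)ᵏ x^{s−k}(U_{s−k+1}(⋯(U_s f)))`; in particular `Dᵏ` maps `xˢ(ker D)`
into `x^{s−k}(ker D)`. -/
theorem iterated_dirac_mapping_property
    {M : Type*} [AddCommGroup M] [Module ℝ M] (n : ℕ) (hn : 0 < n)
    (x D E : Module.End ℝ M)
    (hxD : x * D + D * x = (-2 : ℝ) • E - (n : ℝ) • (1 : Module.End ℝ M))
    (hEx : E * x - x * E = x)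
    (hED : E * D - D * E = -D)
    (s k : ℕ) (hk : 1 ≤ k) (hks : k ≤ s) :
    ∀ f : M, D f = 0 →
      (D ^ k) ((x ^ s) f) =
        ((-2 : ℝ)) ^ k •
          ((x ^ (s - k))
            ((((List.range k).map (fun i => Uop n E (s - k + 1 + i))).prod) f)) ∧
      ∃ g : M, D g = 0 ∧ (D ^ k) ((x ^ s) f) = (x ^ (s - k)) g := by
  intro f hf
  obtain ⟨m, rfl⟩ := Nat.exists_eq_add_of_le' hks
  rw [Nat.add_sub_cancel]
  have key := dirac_pow_pow_apply hxD hEx hED m k hf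
  refine ⟨key, _, ?_, key.trans (map_smul _ _ _).symm⟩
  have hker := apply_list_prod_Uop_eq_zero (n := n) hED
    ((List.range k).map (fun i => m + 1 + i)) hf
  rw [List.map_map] at hker
  rw [map_smul]
  exact (congrArg _ hker).trans (smul_zero _)
end
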